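/- Nondegeneracy of the limit covariance of (A_n, B_n): For every H ∈ (0,1), the matrix J(H) = [[2, j_H], [j_H, e_H]] is positive definite; equivalently, det J(H) = 2 e_H − j_H² > 0, i.e. ( (1/(2π)) ∫_{−π}^{π} ∂_H log f_H(λ) dλ )² < (1/(2π)) ∫_{−π}^{π} |∂_H log f_H(λ)|² dλ. -/

import Mathlib

open MeasureTheory Filter Topology Matrix

noncomputable section

/-- Covariance matrix `T_n(H)` of a standard fractional Gaussian noise: its `(i,j)` entry is
`(|i-j+1|^{2H} - 2|i-j|^{2H} + |i-j-1|^{2H})/2`. -/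
def fgnT (n : ℕ) (H : ℝ) : Matrix (Fin n) (Fin n) ℝ := fun i j =>
  (|((i : ℕ) : ℝ) - ((j : ℕ) : ℝ) + 1| ^ (2 * H)
      - 2 * |((i : ℕ) : ℝ) - ((j : ℕ) : ℝ)| ^ (2 * H)
      + |((i : ℕ) : ℝ) - ((j : ℕ) : ℝ) - 1| ^ (2 * H)) / 2

/-- Quadratic form `⟨x, M x⟩`. -/
def qForm {n : ℕ} (M : Matrix (Fin n) (Fin n) ℝ) (x : Fin n → ℝ) : ℝ :=
  ∑ i, ∑ j, x i * M i j * x j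

/-- Centered Gaussian measure on `ℝⁿ` with nondegenerate covariance matrix `S`, given by its
density with respect to Lebesgue measure. -/
def gaussianPi (n : ℕ) (S : Matrix (Fin n) (Fin n) ℝ) : Measure (Fin n → ℝ) :=
  volume.withDensity fun x => ENNReal.ofReal
    ((2 * Real.pi) ^ (-(n : ℝ) / 2) * S.det ^ (-(1 : ℝ) / 2) *
      Real.exp (-(qForm S⁻¹ x) / 2))

/-- The law `Pⁿ_{(H,σ)}` of fractional Gaussian noise observed with time step `Δ`:
a centered Gaussian measure on `ℝⁿ` with covariance `σ² Δ^{2H} T_n(H)`. -/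
def fgnP (n : ℕ) (Δ H σ : ℝ) : Measure (Fin n → ℝ) :=
  gaussianPi n ((σ ^ 2 * Δ ^ (2 * H)) • fgnT n H)

/-- Spectral density `f_H` of the increments of fractional Brownian motion. -/
def fgnSpec (H l : ℝ) : ℝ :=
  (Real.Gamma (2 * H + 1) * Real.sin (Real.pi * H) / (2 * Real.pi)) *
    (2 * (1 - Real.cos l)) * ∑' k : ℤ, |l + 2 * (k : ℝ) * Real.pi| ^ (-2 * H - 1)

/-- `∂_H log f_H(λ)`. -/
def dlogSpec (H l : ℝ) : ℝ := deriv (fun h : ℝ => Real.log (fgnSpec h l)) H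

/-- `j_H = -(1/(2π)) ∫_{-π}^{π} ∂_H log f_H(λ) dλ`. -/
def jH (H : ℝ) : ℝ := -(1 / (2 * Real.pi)) * ∫ l in (-Real.pi)..Real.pi, dlogSpec H l

/-- `e_H = (1/(4π)) ∫_{-π}^{π} |∂_H log f_H(λ)|² dλ`. -/
def eH (H : ℝ) : ℝ := (1 / (4 * Real.pi)) * ∫ l in (-Real.pi)..Real.pi, (dlogSpec H l) ^ 2

/-- The limit covariance matrix `J(H)` of `(A_n, B_n)`. -/
def Jmat (H : ℝ) : Matrix (Fin 2) (Fin 2) ℝ := !![2, jH H; jH H, eH H]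

/-- Log-likelihood `ℓ_n(H,σ)` of the fGn sample. -/
def loglik (n : ℕ) (Δ H σ : ℝ) (x : Fin n → ℝ) : ℝ :=
  -(n : ℝ) / 2 * Real.log (2 * Real.pi) - (n : ℝ) * H * Real.log Δ - (n : ℝ) * Real.log σ
    - Real.log (fgnT n H).det / 2
    - qForm (fgnT n H)⁻¹ x / (2 * σ ^ 2 * Δ ^ (2 * H))

/-- `C_n = (1/(nσ²Δ^{2H})) ⟨x, T_n(H)⁻¹ x⟩`. -/
def Cstat (n : ℕ) (Δ H σ : ℝ) (x : Fin n → ℝ) : ℝ :=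
  qForm (fgnT n H)⁻¹ x / ((n : ℝ) * σ ^ 2 * Δ ^ (2 * H))

/-- `A_n = √n (C_n - 1)`. -/
def Astat (n : ℕ) (Δ H σ : ℝ) (x : Fin n → ℝ) : ℝ :=
  Real.sqrt n * (Cstat n Δ H σ x - 1)

/-- Entrywise derivative in `H` of `T_n(H)⁻¹`. -/
def dInvT (n : ℕ) (H : ℝ) : Matrix (Fin n) (Fin n) ℝ := fun i j =>
  deriv (fun h : ℝ => (fgnT n h)⁻¹ i j) H

/-- Entrywise second derivative in `H` of `T_n(H)⁻¹`. -/
def d2InvT (n : ℕ) (H : ℝ) : Matrix (Fin n) (Fin n) ℝ := fun i j =>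
  deriv (fun h : ℝ => deriv (fun h' : ℝ => (fgnT n h')⁻¹ i j) h) H

/-- Entrywise derivative in `H` of `T_n(H)`. -/
def dT (n : ℕ) (H : ℝ) : Matrix (Fin n) (Fin n) ℝ := fun i j =>
  deriv (fun h : ℝ => fgnT n h i j) H

/-- `B_n = (1/√n) ( (1/2) ∂_H log det T_n(H) + (1/(2σ²Δ^{2H})) ⟨x, ∂_H(T_n(H)⁻¹) x⟩ )`. -/
def Bstat (n : ℕ) (Δ H σ : ℝ) (x : Fin n → ℝ) : ℝ :=
  (1 / Real.sqrt n) *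
    (deriv (fun h : ℝ => Real.log (fgnT n h).det) H / 2
      + qForm (dInvT n H) x / (2 * σ ^ 2 * Δ ^ (2 * H)))

/-- `D_n = (1/(nσ²Δ^{2H})) ⟨x, ∂_H(T_n(H)⁻¹) x⟩`. -/
def Dstat (n : ℕ) (Δ H σ : ℝ) (x : Fin n → ℝ) : ℝ :=
  qForm (dInvT n H) x / ((n : ℝ) * σ ^ 2 * Δ ^ (2 * H))

/-- `E_n = (1/n) ( (1/2) ∂_H² log det T_n(H) + (1/(2σ²Δ^{2H})) ⟨x, ∂_H²(T_n(H)⁻¹) x⟩ )`. -/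
def Estat (n : ℕ) (Δ H σ : ℝ) (x : Fin n → ℝ) : ℝ :=
  (1 / (n : ℝ)) *
    (deriv (fun h : ℝ => deriv (fun h' : ℝ => Real.log (fgnT n h').det) h) H / 2
      + qForm (d2InvT n H) x / (2 * σ ^ 2 * Δ ^ (2 * H)))

/-- Convergence in law (weak convergence of the laws against bounded continuous functions). -/
def TendstoInLaw {E : Type*} [MeasurableSpace E] [TopologicalSpace E]
    (μ : ℕ → Measure E) (ν : Measure E) : Prop :=
  ∀ g : BoundedContinuousFunction E ℝ,
    Tendsto (fun n => ∫ x, g x ∂μ n) atTop (𝓝 (∫ x, g x ∂ν))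

/-- Convergence in law to the centered Gaussian distribution on `ℝᵈ` with covariance matrix `S`,
expressed through the Cramér–Wold device: every linear functional converges in law to the
corresponding one-dimensional centered Gaussian law. -/
def TendstoInLawGaussian {d : ℕ} (μ : ℕ → Measure (Fin d → ℝ))
    (S : Matrix (Fin d) (Fin d) ℝ) : Prop :=
  ∀ t : Fin d → ℝ,
    TendstoInLaw (fun n => (μ n).map fun z => ∑ i, t i * z i)
      (ProbabilityTheory.gaussianReal 0 (qForm S t).toNNReal)

/-- Convergence in probability to a constant, for statistics defined on varying sample spaces. -/
def TendstoInProb {X : ℕ → Type*} [∀ n, MeasurableSpace (X n)]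
    (μ : ∀ n, Measure (X n)) (f : ∀ n, X n → ℝ) (c : ℝ) : Prop :=
  ∀ ε > 0, Tendsto (fun n => μ n {x | ε ≤ |f n x - c|}) atTop (𝓝 0)

/-- The LAN expansion: the likelihood ratio of `P^n_{θ₀ + φ_n u}` with respect to `P^n_{θ₀}`
is `exp(⟨u, ζ_n⟩ - ½⟨I u, u⟩ + r_n(u))` with `ζ_n → N(0, I)` in law and `r_n(u) → 0` in
probability under `P^n_{θ₀}`. -/
def LANExpansion {X : ℕ → Type*} [∀ n, MeasurableSpace (X n)] {d : ℕ}
    (P : (n : ℕ) → (Fin d → ℝ) → Measure (X n)) (θ₀ : Fin d → ℝ)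
    (φ : ℕ → Matrix (Fin d) (Fin d) ℝ) (I : Matrix (Fin d) (Fin d) ℝ) : Prop :=
  ∃ (ζ : (n : ℕ) → X n → Fin d → ℝ) (r : (n : ℕ) → (Fin d → ℝ) → X n → ℝ),
    (∀ n, Measurable (ζ n)) ∧
    TendstoInLawGaussian (fun n => (P n θ₀).map (ζ n)) I ∧
    ∀ u : Fin d → ℝ,
      (∀ᶠ n in atTop,
        P n (θ₀ + (φ n).mulVec u) = (P n θ₀).withDensity fun x =>
          ENNReal.ofReal (Real.exp (∑ i, u i * ζ n x i - qForm I u / 2 + r n u x))) ∧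
      TendstoInProb (fun n => P n θ₀) (fun n => r n u) 0

/-- Local Asymptotic Normality at `θ₀` with nondegenerate rate matrices `φ_n`
and nondegenerate Fisher information matrix `I`. -/
def IsLAN {X : ℕ → Type*} [∀ n, MeasurableSpace (X n)] {d : ℕ}
    (P : (n : ℕ) → (Fin d → ℝ) → Measure (X n)) (θ₀ : Fin d → ℝ)
    (φ : ℕ → Matrix (Fin d) (Fin d) ℝ) (I : Matrix (Fin d) (Fin d) ℝ) : Prop :=
  (∀ᶠ n in atTop, (φ n).det ≠ 0) ∧ I.det ≠ 0 ∧ LANExpansion P θ₀ φ I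

/-- The `k`-th summand of the aliasing sum in `fgnSpec`, with the singular term `k = 0` removed. -/
def aliasTerm (k : ℤ) (h l : ℝ) : ℝ :=
  if k = 0 then 0 else |l + 2 * (k : ℝ) * Real.pi| ^ (-2 * h - 1)

/-- The derivative of `aliasTerm` with respect to the Hurst index. -/
def aliasTermDeriv (k : ℤ) (h l : ℝ) : ℝ :=
  if k = 0 then 0 else
    Real.log |l + 2 * (k : ℝ) * Real.pi| * (-2) * |l + 2 * (k : ℝ) * Real.pi| ^ (-2 * h - 1)

/-- The regular part of the aliasing sum in `fgnSpec`. -/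
def aliasSum (h l : ℝ) : ℝ := ∑' k : ℤ, aliasTerm k h l

/-- The termwise derivative of `aliasSum` with respect to the Hurst index. -/
def aliasSumDeriv (h l : ℝ) : ℝ := ∑' k : ℤ, aliasTermDeriv k h l

lemma abs_int_le_abs_shift {k : ℤ} (hk : k ≠ 0) {l : ℝ} (hl : |l| ≤ Real.pi) :
    1 ≤ |(k : ℝ)| ∧ |(k : ℝ)| ≤ |l + 2 * (k : ℝ) * Real.pi| := by
  have h1 : (1 : ℝ) ≤ |(k : ℝ)| := by exact_mod_cast Int.one_le_abs hk
  refine ⟨h1, ?_⟩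
  have hpi := Real.pi_gt_three
  have h2 : |2 * (k : ℝ) * Real.pi| - |l| ≤ |l + 2 * (k : ℝ) * Real.pi| := by
    have := abs_sub_abs_le_abs_sub (2 * (k : ℝ) * Real.pi) (-l)
    rw [abs_neg] at this
    rwa [sub_neg_eq_add, add_comm _ l] at this
  rw [abs_mul, abs_mul, abs_of_pos Real.pi_pos, abs_two] at h2
  nlinarith

lemma summable_alias_majorant {δ : ℝ} (hδ : 0 < δ) :
    Summable fun k : ℤ => 2 / δ * |(k : ℝ)| ^ (-(1 + δ)) :=
  (Real.summable_abs_int_rpow (by linarith)).mul_left _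

lemma abs_aliasTerm_le {δ h l : ℝ} (hδ : 0 < δ) (hδ1 : δ < 1) (hh : δ < h)
    (hl : |l| ≤ Real.pi) (k : ℤ) :
    |aliasTerm k h l| ≤ 2 / δ * |(k : ℝ)| ^ (-(1 + δ)) := by
  unfold aliasTerm
  split_ifs with hk
  · rw [abs_zero]; positivity
  obtain ⟨h1, h2⟩ := abs_int_le_abs_shift hk hl
  rw [abs_of_nonneg (by positivity)]
  have h3 : (1 : ℝ) ≤ 2 / δ := by rw [le_div_iff₀ hδ]; linarith
  calc |l + 2 * (k : ℝ) * Real.pi| ^ (-2 * h - 1)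
      ≤ |l + 2 * (k : ℝ) * Real.pi| ^ (-(1 + δ)) :=
        Real.rpow_le_rpow_of_exponent_le (h1.trans h2) (by linarith)
    _ ≤ |(k : ℝ)| ^ (-(1 + δ)) :=
        Real.rpow_le_rpow_of_nonpos (by linarith) h2 (by linarith)
    _ ≤ _ := le_mul_of_one_le_left (by positivity) h3

lemma abs_aliasTermDeriv_le {δ h l : ℝ} (hδ : 0 < δ) (hh : δ < h)
    (hl : |l| ≤ Real.pi) (k : ℤ) :
    |aliasTermDeriv k h l| ≤ 2 / δ * |(k : ℝ)| ^ (-(1 + δ)) := by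
  unfold aliasTermDeriv
  split_ifs with hk
  · rw [abs_zero]; positivity
  obtain ⟨h1, h2⟩ := abs_int_le_abs_shift hk hl
  set x := |l + 2 * (k : ℝ) * Real.pi|
  have hx : 1 ≤ x := h1.trans h2
  have hlog : 0 ≤ Real.log x := Real.log_nonneg hx
  rw [abs_mul, abs_mul, abs_of_nonneg hlog, abs_neg, abs_two, abs_of_nonneg (by positivity)]
  calc Real.log x * 2 * x ^ (-2 * h - 1)
      ≤ x ^ δ / δ * 2 * x ^ (-2 * h - 1) := by
        gcongr
        exact Real.log_le_rpow_div (by linarith) hδ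
    _ = 2 / δ * x ^ (δ + (-2 * h - 1)) := by
        rw [Real.rpow_add (by linarith)]; ring
    _ ≤ 2 / δ * x ^ (-(1 + δ)) := by
        gcongr
        linarith
    _ ≤ _ := by
        gcongr ?_ * ?_
        exact Real.rpow_le_rpow_of_nonpos (by linarith) h2 (by linarith)

lemma summable_aliasTerm {h l : ℝ} (hh : 0 < h) (hh1 : h < 1) (hl : |l| ≤ Real.pi) :
    Summable fun k => aliasTerm k h l :=
  .of_norm_bounded (summable_alias_majorant (half_pos hh))
    (abs_aliasTerm_le (half_pos hh) (by linarith) (half_lt_self hh) hl)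

lemma hasDerivAt_aliasSum {h l : ℝ} (hh : 0 < h) (hh1 : h < 1) (hl : |l| ≤ Real.pi) :
    HasDerivAt (fun h => aliasSum h l) (aliasSumDeriv h l) h := by
  refine hasDerivAt_tsum_of_isPreconnected (g := fun k h => aliasTerm k h l)
    (g' := fun k h => aliasTermDeriv k h l) (summable_alias_majorant (half_pos hh))
    isOpen_Ioi isPreconnected_Ioi (fun k y _ => ?_)
    (fun k y hy => abs_aliasTermDeriv_le (half_pos hh) hy hl k) (half_lt_self hh)
    (summable_aliasTerm hh hh1 hl) (half_lt_self hh)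
  unfold aliasTerm aliasTermDeriv
  split_ifs with hk
  · exact hasDerivAt_const _ _
  obtain ⟨h1, h2⟩ := abs_int_le_abs_shift hk hl
  refine HasDerivAt.const_rpow (by linarith) ?_
  simpa using ((hasDerivAt_id y).const_mul (-2 : ℝ)).sub_const 1

lemma aliasSum_nonneg (h l : ℝ) : 0 ≤ aliasSum h l :=
  tsum_nonneg fun k => by unfold aliasTerm; split_ifs <;> positivity

lemma exists_aliasSum_bound {h : ℝ} (hh : 0 < h) (hh1 : h < 1) :
    ∃ K, 0 ≤ K ∧ ∀ l, |l| ≤ Real.pi → aliasSum h l ≤ K ∧ |aliasSumDeriv h l| ≤ K := by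
  have hs := (summable_alias_majorant (half_pos hh)).hasSum
  refine ⟨∑' k : ℤ, 2 / (h / 2) * |(k : ℝ)| ^ (-(1 + h / 2)),
    tsum_nonneg fun k => by positivity, fun l hl => ⟨(le_abs_self _).trans ?_, ?_⟩⟩
  · exact tsum_of_norm_bounded (f := fun k => aliasTerm k h l) hs
      (abs_aliasTerm_le (half_pos hh) (by linarith) (half_lt_self hh) hl)
  · exact tsum_of_norm_bounded (f := fun k => aliasTermDeriv k h l) hs
      (abs_aliasTermDeriv_le (half_pos hh) (half_lt_self hh) hl)

lemma measurable_aliasSum (h : ℝ) : Measurable (aliasSum h) := by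
  refine Measurable.tsum fun k => ?_
  unfold aliasTerm
  split_ifs <;> fun_prop

lemma measurable_aliasSumDeriv (h : ℝ) : Measurable (aliasSumDeriv h) := by
  refine Measurable.tsum fun k => ?_
  unfold aliasTermDeriv
  split_ifs
  · fun_prop
  · exact ((Real.measurable_log.comp (by fun_prop)).mul_const _).mul (by fun_prop)

/-- Multiplicative constant of the spectral density. -/
def specConst (h : ℝ) : ℝ :=
  Real.Gamma (2 * h + 1) * Real.sin (Real.pi * h) / (2 * Real.pi)

lemma specConst_pos {h : ℝ} (hh : 0 < h) (hh1 : h < 1) : 0 < specConst h := by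
  have hpi := Real.pi_pos
  have h1 : 0 < Real.Gamma (2 * h + 1) := Real.Gamma_pos_of_pos (by linarith)
  have h2 : 0 < Real.sin (Real.pi * h) :=
    Real.sin_pos_of_pos_of_lt_pi (by positivity) (by nlinarith)
  unfold specConst
  positivity

lemma differentiableAt_specConst {h : ℝ} (hh : 0 < h) : DifferentiableAt ℝ specConst h := by
  have h1 : DifferentiableAt ℝ Real.Gamma (2 * h + 1) :=
    Real.differentiableAt_Gamma fun m hm => by
      have : (0 : ℝ) ≤ m := m.cast_nonneg
      linarith
  have h2 : DifferentiableAt ℝ (fun h : ℝ => Real.Gamma (2 * h + 1)) h :=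
    h1.comp h (f := fun h : ℝ => 2 * h + 1) (by fun_prop)
  unfold specConst
  exact (h2.mul (by fun_prop)).div_const _

lemma fgnSpec_eq {h l : ℝ} (hh : 0 < h) (hh1 : h < 1) (hl : |l| ≤ Real.pi) :
    fgnSpec h l = specConst h * (2 * (1 - Real.cos l)) *
      (|l| ^ (-2 * h - 1) + aliasSum h l) := by
  unfold fgnSpec specConst
  congr 1
  rw [Summable.tsum_eq_add_tsum_ite' 0]
  · simp [aliasSum, aliasTerm]
  · convert summable_aliasTerm hh hh1 hl using 1
    ext k
    simp [aliasTerm, Function.update_apply]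

lemma dlogSpec_eq {h l : ℝ} (hh : 0 < h) (hh1 : h < 1) (hl0 : l ≠ 0) (hl : |l| ≤ Real.pi) :
    dlogSpec h l = deriv specConst h / specConst h +
      (-2 * Real.log |l| + |l| ^ (2 * h + 1) * aliasSumDeriv h l) /
        (1 + |l| ^ (2 * h + 1) * aliasSum h l) := by
  have hc := specConst_pos hh hh1
  have hlpos : 0 < |l| := abs_pos.2 hl0
  have hpi := Real.pi_pos
  have hb : 2 * (1 - Real.cos l) ≠ 0 := by
    have : Real.cos l ≠ 1 := fun h' => hl0
      ((Real.cos_eq_one_iff_of_lt_of_lt (by linarith [neg_abs_le l])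
        (by linarith [le_abs_self l])).1 h')
    intro h'
    exact this (by linarith)
  have hR := aliasSum_nonneg h l
  have hp : 0 < |l| ^ (-2 * h - 1) := by positivity
  have hS : HasDerivAt (fun h => |l| ^ (-2 * h - 1) + aliasSum h l)
      (Real.log |l| * (-2) * |l| ^ (-2 * h - 1) + aliasSumDeriv h l) h := by
    refine HasDerivAt.add (HasDerivAt.const_rpow hlpos ?_) (hasDerivAt_aliasSum hh hh1 hl)
    simpa using ((hasDerivAt_id h).const_mul (-2 : ℝ)).sub_const 1
  have hf := (((differentiableAt_specConst hh).hasDerivAt.mul_const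
    (2 * (1 - Real.cos l))).mul hS).log (mul_ne_zero (mul_ne_zero hc.ne' hb) (by positivity))
  have heq : (fun h : ℝ => Real.log (fgnSpec h l)) =ᶠ[𝓝 h] fun h => Real.log
      (specConst h * (2 * (1 - Real.cos l)) * (|l| ^ (-2 * h - 1) + aliasSum h l)) := by
    filter_upwards [Ioo_mem_nhds hh hh1] with y hy
    rw [fgnSpec_eq hy.1 hy.2 hl]
  unfold dlogSpec
  refine (hf.congr_of_eventuallyEq heq).deriv.trans ?_
  have hq : |l| ^ (2 * h + 1) = (|l| ^ (-2 * h - 1))⁻¹ := by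
    rw [← Real.rpow_neg hlpos.le]; ring_nf
  simp only [Pi.mul_apply]
  rw [hq]
  generalize |l| ^ (-2 * h - 1) = p at *
  generalize aliasSum h l = R at *
  have h3 : p + R ≠ 0 := by positivity
  generalize 2 * (1 - Real.cos l) = b at *
  have hp' := hp.ne'
  have hc' := hc.ne'
  have h5 : 1 + p⁻¹ * R = (p + R) / p := by field_simp
  rw [h5]
  field_simp

lemma exists_abs_dlogSpec_le {h : ℝ} (hh : 0 < h) (hh1 : h < 1) :
    ∃ A, ∀ l, l ≠ 0 → |l| ≤ Real.pi → |dlogSpec h l| ≤ A + 8 * |l| ^ (-(1 / 4) : ℝ) := by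
  obtain ⟨K, hK, hb⟩ := exists_aliasSum_bound hh hh1
  refine ⟨|deriv specConst h / specConst h| + 2 * Real.pi + Real.pi ^ (2 * h + 1) * K,
    fun l hl0 hl => ?_⟩
  have hlpos : 0 < |l| := abs_pos.2 hl0
  have hpi := Real.pi_pos
  have hR := aliasSum_nonneg h l
  have hlog : |Real.log (|l|)| ≤ Real.pi + 4 * |l| ^ (-(1 / 4) : ℝ) := by
    have hq : 0 < |l| ^ (-(1 / 4) : ℝ) := by positivity
    refine abs_le.2 ⟨?_, ?_⟩
    · have := Real.log_le_rpow_div (x := |l|⁻¹) (ε := 1 / 4) (by positivity) (by norm_num)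
      rw [Real.log_inv, Real.inv_rpow hlpos.le, ← Real.rpow_neg hlpos.le] at this
      linarith
    · linarith [Real.log_le_sub_one_of_pos hlpos]
  rw [dlogSpec_eq hh hh1 hl0 hl]
  refine (abs_add_le _ _).trans ?_
  have hden : 1 ≤ 1 + |l| ^ (2 * h + 1) * aliasSum h l := by
    have : 0 ≤ |l| ^ (2 * h + 1) * aliasSum h l := by positivity
    linarith
  have hnum : |(-2 * Real.log |l| + |l| ^ (2 * h + 1) * aliasSumDeriv h l) /
      (1 + |l| ^ (2 * h + 1) * aliasSum h l)| ≤
      2 * |Real.log (|l|)| + Real.pi ^ (2 * h + 1) * K := by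
    rw [abs_div, abs_of_pos (by linarith : 0 < 1 + |l| ^ (2 * h + 1) * aliasSum h l)]
    refine (div_le_self (abs_nonneg _) hden).trans ((abs_add_le _ _).trans ?_)
    rw [abs_mul, abs_mul, abs_neg, abs_two, abs_of_nonneg (by positivity : 0 ≤ |l| ^ (2 * h + 1))]
    gcongr
    exact (hb l hl).2
  linarith

lemma exists_lt_dlogSpec {h : ℝ} (hh : 0 < h) (hh1 : h < 1) (m : ℝ) :
    ∃ δ > 0, δ < Real.pi ∧ ∀ l, 0 < l → l < δ → m < dlogSpec h l := by
  obtain ⟨K, hK, hb⟩ := exists_aliasSum_bound hh hh1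
  have hpi := Real.pi_gt_three
  set c := deriv specConst h / specConst h
  set T := K + (1 + K) * |m - c| with hT
  have hT0 : 0 ≤ T := by positivity
  refine ⟨Real.exp (-T / 2), Real.exp_pos _, ?_, fun l hl hlδ => ?_⟩
  · have : Real.exp (-T / 2) ≤ 1 := Real.exp_le_one_iff.2 (by linarith)
    linarith
  have hl1 : l ≤ 1 := hlδ.le.trans (Real.exp_le_one_iff.2 (by linarith))
  have habs : |l| = l := abs_of_pos hl
  have hlog : Real.log l < -T / 2 := (Real.log_lt_iff_lt_exp hl).2 hlδ
  have hlpi : |l| ≤ Real.pi := by rw [habs]; linarith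
  rw [dlogSpec_eq hh hh1 hl.ne' hlpi, habs]
  obtain ⟨hb1, hb2⟩ := hb l hlpi
  have hR := aliasSum_nonneg h l
  have hq0 : 0 ≤ l ^ (2 * h + 1) := by positivity
  have hq1 : l ^ (2 * h + 1) ≤ 1 := Real.rpow_le_one hl.le hl1 (by linarith)
  have hden : l ^ (2 * h + 1) * aliasSum h l ≤ K := by nlinarith
  have hden0 : 0 ≤ l ^ (2 * h + 1) * aliasSum h l := by positivity
  have hnum : -K ≤ l ^ (2 * h + 1) * aliasSumDeriv h l := by nlinarith [(abs_le.1 hb2).1]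
  have key : m - c < (-2 * Real.log l + l ^ (2 * h + 1) * aliasSumDeriv h l) /
      (1 + l ^ (2 * h + 1) * aliasSum h l) := by
    rw [lt_div_iff₀ (by linarith)]
    nlinarith [le_abs_self (m - c), abs_nonneg (m - c)]
  linarith

lemma aestronglyMeasurable_dlogSpec {h : ℝ} (hh : 0 < h) (hh1 : h < 1) :
    AEStronglyMeasurable (dlogSpec h) (volume.restrict (Set.Ioc (-Real.pi) Real.pi)) := by
  have hm : Measurable fun l => deriv specConst h / specConst h +
      (-2 * Real.log |l| + |l| ^ (2 * h + 1) * aliasSumDeriv h l) /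
        (1 + |l| ^ (2 * h + 1) * aliasSum h l) := by
    have h1 := measurable_aliasSum h
    have h2 := measurable_aliasSumDeriv h
    have h3 : Measurable fun l : ℝ => Real.log |l| := Real.measurable_log.comp (by fun_prop)
    fun_prop
  refine hm.aestronglyMeasurable.congr ?_
  filter_upwards [ae_restrict_mem measurableSet_Ioc, Measure.ae_ne _ (0 : ℝ)] with l hl hl0
  exact (dlogSpec_eq hh hh1 hl0 (abs_le.2 ⟨hl.1.le, hl.2⟩)).symm

lemma intervalIntegrable_abs_rpow {r : ℝ} (hr : -1 < r) (a b : ℝ) :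
    IntervalIntegrable (fun x : ℝ => |x| ^ r) volume a b := by
  refine intervalIntegrable_of_even (by simp) (fun x hx => ?_) (by simp) (by simp)
  refine (intervalIntegral.intervalIntegrable_rpow' hr).congr fun y hy => ?_
  rw [Set.uIoc_of_le hx.le] at hy
  simp only [abs_of_pos hy.1]

lemma intervalIntegrable_dlogSpec_sq {h : ℝ} (hh : 0 < h) (hh1 : h < 1) :
    IntervalIntegrable (fun l => dlogSpec h l ^ 2) volume (-Real.pi) Real.pi := by
  have hpi := Real.pi_pos
  obtain ⟨A, hA⟩ := exists_abs_dlogSpec_le hh hh1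
  have hg : IntervalIntegrable (fun l : ℝ => 2 * A ^ 2 + 128 * |l| ^ (-(1 / 2) : ℝ)) volume
      (-Real.pi) Real.pi :=
    intervalIntegrable_const.add ((intervalIntegrable_abs_rpow (by norm_num) _ _).const_mul _)
  rw [intervalIntegrable_iff_integrableOn_Ioc_of_le (by linarith)] at hg ⊢
  refine hg.mono' ((aestronglyMeasurable_dlogSpec hh hh1).pow 2) ?_
  filter_upwards [ae_restrict_mem measurableSet_Ioc, Measure.ae_ne _ (0 : ℝ)] with l hl hl0
  have hlpos : 0 < |l| := abs_pos.2 hl0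
  have hb := hA l hl0 (abs_le.2 ⟨hl.1.le, hl.2⟩)
  have hsq : |l| ^ (-(1 / 2) : ℝ) = (|l| ^ (-(1 / 4) : ℝ)) ^ 2 := by
    rw [← Real.rpow_natCast, ← Real.rpow_mul hlpos.le]; norm_num
  rw [Real.norm_of_nonneg (sq_nonneg _), hsq, ← sq_abs]
  nlinarith [abs_nonneg (dlogSpec h l), sq_nonneg (A - 8 * |l| ^ (-(1 / 4) : ℝ))]

lemma intervalIntegrable_dlogSpec {h : ℝ} (hh : 0 < h) (hh1 : h < 1) :
    IntervalIntegrable (dlogSpec h) volume (-Real.pi) Real.pi := by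
  have hpi := Real.pi_pos
  have hg := (intervalIntegrable_const (c := (1 : ℝ))).add (intervalIntegrable_dlogSpec_sq hh hh1)
  rw [intervalIntegrable_iff_integrableOn_Ioc_of_le (by linarith)] at hg ⊢
  refine hg.mono' (aestronglyMeasurable_dlogSpec hh hh1) (.of_forall fun l => ?_)
  simp only [Real.norm_eq_abs]
  rw [← sq_abs]
  nlinarith [sq_nonneg (|dlogSpec h l| - 1)]

lemma sq_mean_dlogSpec_lt {h : ℝ} (hh : 0 < h) (hh1 : h < 1) :
    ((1 / (2 * Real.pi)) * ∫ l in (-Real.pi)..Real.pi, dlogSpec h l) ^ 2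
      < (1 / (2 * Real.pi)) * ∫ l in (-Real.pi)..Real.pi, (dlogSpec h l) ^ 2 := by
  have hpi := Real.pi_pos
  have hi1 := intervalIntegrable_dlogSpec hh hh1
  have hi2 := intervalIntegrable_dlogSpec_sq hh hh1
  set m := (1 / (2 * Real.pi)) * ∫ l in (-Real.pi)..Real.pi, dlogSpec h l with hm
  have hexp : ∀ l, (dlogSpec h l - m) ^ 2 = dlogSpec h l ^ 2 - 2 * m * dlogSpec h l + m ^ 2 :=
    fun l => by ring
  have hi3 : IntervalIntegrable (fun l => (dlogSpec h l - m) ^ 2) volume (-Real.pi) Real.pi := by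
    simp only [hexp]
    exact (hi2.sub (hi1.const_mul _)).add intervalIntegrable_const
  have hpos : 0 < ∫ l in (-Real.pi)..Real.pi, (dlogSpec h l - m) ^ 2 := by
    rw [intervalIntegral.integral_pos_iff_support_of_nonneg_ae
      (.of_forall fun l => sq_nonneg _) hi3]
    refine ⟨by linarith, ?_⟩
    obtain ⟨δ, hδ, hδpi, hlt⟩ := exists_lt_dlogSpec hh hh1 m
    refine lt_of_lt_of_le (b := volume (Set.Ioo 0 δ)) (by simpa using hδ) (measure_mono ?_)
    intro l hl
    refine ⟨?_, by linarith [hl.1], by linarith [hl.2]⟩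
    have := hlt l hl.1 hl.2
    exact pow_ne_zero 2 (by linarith)
  have hint : ∫ l in (-Real.pi)..Real.pi, dlogSpec h l = 2 * Real.pi * m := by
    rw [hm]; field_simp
  simp only [hexp] at hpos
  rw [intervalIntegral.integral_add (hi2.sub (hi1.const_mul _)) intervalIntegrable_const,
    intervalIntegral.integral_sub hi2 (hi1.const_mul _), intervalIntegral.integral_const_mul,
    intervalIntegral.integral_const, hint, smul_eq_mul] at hpos
  rw [one_div, inv_mul_eq_div, lt_div_iff₀ (by positivity)]
  nlinarith

lemma posDef_fin_two_of_det_pos {a b d : ℝ} (ha : 0 < a) (hdet : 0 < a * d - b ^ 2) :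
    (!![a, b; b, d]).PosDef := by
  refine .of_dotProduct_mulVec_pos (by ext i j; fin_cases i <;> fin_cases j <;> simp)
    fun x hx => ?_
  have hform : star x ⬝ᵥ !![a, b; b, d].mulVec x =
      a * x 0 ^ 2 + 2 * b * x 0 * x 1 + d * x 1 ^ 2 := by
    simp [dotProduct, Matrix.mulVec, Fin.sum_univ_two]
    ring
  rw [hform]
  by_cases h1 : x 1 = 0
  · have h0 : x 0 ≠ 0 := fun h0 => hx (by ext i; fin_cases i <;> simp [h0, h1])
    rw [h1]
    have : 0 < a * x 0 ^ 2 := by positivity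
    linarith
  · have h2 : 0 < (a * d - b ^ 2) * x 1 ^ 2 := by positivity
    have h3 : 0 < a * (a * x 0 ^ 2 + 2 * b * x 0 * x 1 + d * x 1 ^ 2) := by
      nlinarith [sq_nonneg (a * x 0 + b * x 1)]
    exact pos_of_mul_pos_right h3 ha.le

/-- **Nondegeneracy of the limit covariance of `(A_n, B_n)`.** For every `H ∈ (0,1)`, the
matrix `J(H) = [[2, j_H], [j_H, e_H]]` is positive definite; equivalently
`det J(H) = 2e_H − j_H² > 0`, i.e. `((1/(2π))∫ ∂_H log f_H)² < (1/(2π))∫ |∂_H log f_H|²`. -/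
theorem Jmat_posDef (H : ℝ) (hH : H ∈ Set.Ioo (0 : ℝ) 1) :
    (Jmat H).PosDef ∧ (Jmat H).det = 2 * eH H - jH H ^ 2 ∧ 0 < 2 * eH H - jH H ^ 2 ∧
      ((1 / (2 * Real.pi)) * ∫ l in (-Real.pi)..Real.pi, dlogSpec H l) ^ 2
        < (1 / (2 * Real.pi)) * ∫ l in (-Real.pi)..Real.pi, (dlogSpec H l) ^ 2 := by
  obtain ⟨hH0, hH1⟩ := hH
  have hlt := sq_mean_dlogSpec_lt hH0 hH1
  have hpi := Real.pi_pos
  have hpos : 0 < 2 * eH H - jH H ^ 2 := by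
    have h1 : 2 * eH H = (1 / (2 * Real.pi)) * ∫ l in (-Real.pi)..Real.pi, dlogSpec H l ^ 2 := by
      unfold eH
      field_simp
      ring
    have h2 : jH H ^ 2 = ((1 / (2 * Real.pi)) * ∫ l in (-Real.pi)..Real.pi, dlogSpec H l) ^ 2 := by
      unfold jH
      ring
    linarith
  refine ⟨posDef_fin_two_of_det_pos two_pos hpos, ?_, hpos, hlt⟩
  simp only [Jmat, det_fin_two_of]
  ring
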